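/- Let X ~ N(θ, Σ) with Σ positive definite and d > 2, and define the James–Stein estimator θ̂(X) = (1 - (d-2)/(XᵀΣ⁻¹X)) X. Then E[(θ̂ - θ)ᵀΣ⁻¹(θ̂ - θ)] = d - (d-2)² E[1/(XᵀΣ⁻¹X)]. -/

import Mathlib

open MeasureTheory ProbabilityTheory Matrix

/-- A random vector `X` has the multivariate Gaussian law `N(θ, C)` under `μ` iff every
linear functional of `X` has the corresponding one-dimensional Gaussian law. -/
def HasGaussianLaw {Ω ι : Type*} [Fintype ι] [MeasurableSpace Ω] (μ : Measure Ω)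
    (X : Ω → ι → ℝ) (θ : ι → ℝ) (C : Matrix ι ι ℝ) : Prop :=
  ∀ a : ι → ℝ, Measure.map (fun ω => a ⬝ᵥ X ω) μ =
    gaussianReal (a ⬝ᵥ θ) (Real.toNNReal (a ⬝ᵥ C.mulVec a))

open Real Set Filter Topology

/-- Exponentially tilting `N(m, 1)` by `exp (-s x²)` gives a multiple of
`N(m / (1 + 2s), 1 / (1 + 2s))`. -/
lemma integral_mul_exp_neg_mul_sq_gaussianReal (f : ℝ → ℝ) (m : ℝ) {s : ℝ} (hs : 0 ≤ s) :
    ∫ x, f x * exp (-s * x ^ 2) ∂gaussianReal m 1 =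
      exp (-(log (1 + 2 * s) / 2) - s * m ^ 2 / (1 + 2 * s)) *
        ∫ x, f x ∂gaussianReal (m / (1 + 2 * s)) (1 + 2 * s)⁻¹.toNNReal := by
  have hp : 0 < 1 + 2 * s := by positivity
  have hv : (1 + 2 * s)⁻¹.toNNReal ≠ 0 := by simpa using hp
  rw [integral_gaussianReal_eq_integral_smul one_ne_zero,
    integral_gaussianReal_eq_integral_smul hv, ← integral_const_mul]
  congr 1 with x
  have hsqrt : √(1 + 2 * s) = exp (log (1 + 2 * s) / 2) := by
    rw [sqrt_eq_rpow, rpow_def_of_pos hp]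
    ring_nf
  have hc : (√(2 * π * (1 + 2 * s)⁻¹))⁻¹ = (√(2 * π))⁻¹ * exp (log (1 + 2 * s) / 2) := by
    rw [← hsqrt, sqrt_mul (by positivity), sqrt_inv, mul_inv, inv_inv]
  simp only [gaussianPDFReal_def, smul_eq_mul, Real.coe_toNNReal _ (inv_nonneg.2 hp.le), hc,
    NNReal.coe_one, mul_one]
  have he : exp (-(x - m) ^ 2 / 2) * exp (-s * x ^ 2) =
      exp (-(log (1 + 2 * s) / 2) - s * m ^ 2 / (1 + 2 * s)) * exp (log (1 + 2 * s) / 2) *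
        exp (-(x - m / (1 + 2 * s)) ^ 2 / (2 * (1 + 2 * s)⁻¹)) := by
    simp only [← exp_add]
    congr 1
    field_simp
    ring
  linear_combination (√(2 * π))⁻¹ * f x * he

section IsotropicGaussian

variable {ι : Type*} [Fintype ι] (m : ι → ℝ)

lemma exp_neg_mul_dotProduct_self (s : ℝ) (y : ι → ℝ) :
    exp (-s * (y ⬝ᵥ y)) = ∏ i, exp (-s * y i ^ 2) := by
  rw [← exp_sum, dotProduct, Finset.mul_sum]
  simp only [sq]

/-- The Laplace transform at `s` of `|Y|²`, for `Y` Gaussian with mean `m` and identity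
covariance. -/
noncomputable def laplaceNormSq (m : ι → ℝ) (s : ℝ) : ℝ :=
  exp (-(Fintype.card ι / 2 * log (1 + 2 * s)) - s * (m ⬝ᵥ m) / (1 + 2 * s))

lemma laplaceNormSq_eq_prod (s : ℝ) : laplaceNormSq m s =
    ∏ i, exp (-(log (1 + 2 * s) / 2) - s * m i ^ 2 / (1 + 2 * s)) := by
  rw [← exp_sum, laplaceNormSq, Finset.sum_sub_distrib, ← Finset.sum_div, ← Finset.mul_sum]
  simp only [dotProduct, sq, Finset.sum_const, Finset.card_univ, nsmul_eq_mul]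
  ring_nf

lemma integral_exp_neg_mul_dotProduct_self {s : ℝ} (hs : 0 ≤ s) :
    ∫ y, exp (-s * (y ⬝ᵥ y)) ∂Measure.pi (fun i ↦ gaussianReal (m i) 1) = laplaceNormSq m s := by
  simp_rw [exp_neg_mul_dotProduct_self]
  rw [integral_fintype_prod_eq_prod (𝕜 := ℝ) (fun _ x ↦ exp (-s * x ^ 2)), laplaceNormSq_eq_prod]
  congr 1 with i
  simpa using integral_mul_exp_neg_mul_sq_gaussianReal (fun _ ↦ 1) (m i) hs

lemma integral_eval_mul_exp_neg_mul_dotProduct_self (i : ι) {s : ℝ} (hs : 0 ≤ s) :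
    ∫ y, y i * exp (-s * (y ⬝ᵥ y)) ∂Measure.pi (fun i ↦ gaussianReal (m i) 1) =
      m i / (1 + 2 * s) * laplaceNormSq m s := by
  classical
  have h (y : ι → ℝ) : y i * exp (-s * (y ⬝ᵥ y)) =
      ∏ j, (if j = i then y j else 1) * exp (-s * y j ^ 2) := by
    rw [exp_neg_mul_dotProduct_self, Finset.prod_mul_distrib, Finset.prod_ite_eq']
    simp
  simp_rw [h]
  rw [integral_fintype_prod_eq_prod (𝕜 := ℝ)
    (fun j x ↦ (if j = i then x else 1) * exp (-s * x ^ 2)), laplaceNormSq_eq_prod]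
  have h' (j : ι) : ∫ x, (if j = i then x else 1) * exp (-s * x ^ 2) ∂gaussianReal (m j) 1 =
      (if j = i then m j / (1 + 2 * s) else 1) *
        exp (-(log (1 + 2 * s) / 2) - s * m j ^ 2 / (1 + 2 * s)) := by
    rw [integral_mul_exp_neg_mul_sq_gaussianReal (fun x ↦ if j = i then x else 1) (m j) hs, mul_comm]
    split_ifs <;> simp
  simp_rw [h', Finset.prod_mul_distrib, Finset.prod_ite_eq']
  simp

lemma dotProduct_self_nonneg_of_real (y : ι → ℝ) : 0 ≤ y ⬝ᵥ y :=
  Finset.sum_nonneg fun i _ ↦ mul_self_nonneg (y i)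

lemma integral_exp_neg_mul_Ioi {q : ℝ} (hq : 0 ≤ q) : ∫ s in Ioi 0, exp (-s * q) = q⁻¹ := by
  rcases hq.eq_or_lt with rfl | hq
  · simp [Measure.real]
  · have := integral_exp_mul_Ioi (neg_lt_zero.2 hq) 0
    simp only [neg_mul, mul_comm q] at this
    simpa using this

lemma hasDerivAt_mul_laplaceNormSq {s : ℝ} (hs : 0 ≤ s) :
    HasDerivAt (fun s ↦ (1 + 2 * s) * laplaceNormSq m s)
      ((2 - Fintype.card ι) * laplaceNormSq m s -
        (m ⬝ᵥ m) * (1 + 2 * s)⁻¹ * laplaceNormSq m s) s := by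
  have hp : 1 + 2 * s ≠ 0 := by positivity
  have h1 : HasDerivAt (fun s : ℝ ↦ 1 + 2 * s) 2 s := by
    simpa using ((hasDerivAt_id s).const_mul 2).const_add 1
  have h2 := (((h1.log hp).const_mul (Fintype.card ι / 2 : ℝ)).neg.sub
    (((hasDerivAt_id s).mul_const (m ⬝ᵥ m)).div h1 hp)).exp
  refine (h1.mul h2).congr_deriv ?_
  simp only [laplaceNormSq, id, Pi.sub_apply, Pi.neg_apply, Pi.div_apply]
  field_simp
  ring

lemma laplaceNormSq_nonneg (s : ℝ) : 0 ≤ laplaceNormSq m s := (exp_pos _).le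

lemma tendsto_mul_laplaceNormSq (hd : 2 < Fintype.card ι) :
    Tendsto (fun s ↦ (1 + 2 * s) * laplaceNormSq m s) atTop (𝓝 0) := by
  have hd' : (0 : ℝ) < Fintype.card ι / 2 - 1 := by
    have : (2 : ℝ) < Fintype.card ι := by exact_mod_cast hd
    linarith
  have hlog : Tendsto (fun s : ℝ ↦ log (1 + 2 * s)) atTop atTop :=
    tendsto_log_atTop.comp (tendsto_atTop_add_const_left _ _ (tendsto_id.const_mul_atTop two_pos))
  have hlim := tendsto_exp_neg_atTop_nhds_zero.comp (hlog.const_mul_atTop hd')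
  refine tendsto_of_tendsto_of_tendsto_of_le_of_le' tendsto_const_nhds hlim ?_ ?_
  · filter_upwards [eventually_ge_atTop 0] with s hs
    exact mul_nonneg (by positivity) (laplaceNormSq_nonneg m s)
  · filter_upwards [eventually_ge_atTop 0] with s hs
    have hp : 0 < 1 + 2 * s := by positivity
    have := dotProduct_self_nonneg_of_real m
    have : 0 ≤ s * (m ⬝ᵥ m) / (1 + 2 * s) := by positivity
    calc (1 + 2 * s) * laplaceNormSq m s
        = exp (log (1 + 2 * s)) * laplaceNormSq m s := by rw [exp_log hp]
      _ ≤ _ := by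
        rw [laplaceNormSq, ← exp_add]
        exact exp_le_exp.2 (by linarith)

lemma measurable_laplaceNormSq : Measurable (laplaceNormSq m) := by
  unfold laplaceNormSq
  fun_prop

lemma integrableOn_laplaceNormSq (hd : 2 < Fintype.card ι) :
    IntegrableOn (laplaceNormSq m) (Ioi 0) := by
  have hd' : (1 : ℝ) ≤ Fintype.card ι - 2 := by
    have : ((2 + 1 : ℕ) : ℝ) ≤ Fintype.card ι := by exact_mod_cast hd
    push_cast at this
    linarith
  have hM := dotProduct_self_nonneg_of_real m
  have hle : ∀ s ∈ Ioi (0 : ℝ), laplaceNormSq m s ≤ -((2 - Fintype.card ι) * laplaceNormSq m s -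
        (m ⬝ᵥ m) * (1 + 2 * s)⁻¹ * laplaceNormSq m s) := fun s hs ↦ by
    have hs' : (0 : ℝ) < s := hs
    have hL := laplaceNormSq_nonneg m s
    have : 0 ≤ (m ⬝ᵥ m) * (1 + 2 * s)⁻¹ * laplaceNormSq m s := by positivity
    nlinarith
  have hint := integrableOn_Ioi_deriv_of_nonpos'
    (fun s hs ↦ hasDerivAt_mul_laplaceNormSq m (mem_Ici.1 hs))
    (fun s hs ↦ by linarith [hle s hs, laplaceNormSq_nonneg m s]) (tendsto_mul_laplaceNormSq m hd)
  refine Integrable.mono' hint.neg (measurable_laplaceNormSq m).aestronglyMeasurable ?_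
  refine (ae_restrict_iff' measurableSet_Ioi).2 (.of_forall fun s hs ↦ ?_)
  rw [norm_of_nonneg (laplaceNormSq_nonneg m s)]
  exact hle s hs

lemma integrableOn_inv_mul_laplaceNormSq (hd : 2 < Fintype.card ι) :
    IntegrableOn (fun s ↦ (1 + 2 * s)⁻¹ * laplaceNormSq m s) (Ioi 0) := by
  refine (integrableOn_laplaceNormSq m hd).mono'
    ((by fun_prop : Measurable fun s : ℝ ↦ (1 + 2 * s)⁻¹).mul
      (measurable_laplaceNormSq m)).aestronglyMeasurable ?_
  refine (ae_restrict_iff' measurableSet_Ioi).2 (.of_forall fun s hs ↦ ?_)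
  have hs' : (0 : ℝ) < s := hs
  have hL := laplaceNormSq_nonneg m s
  rw [norm_of_nonneg (by positivity)]
  exact mul_le_of_le_one_left hL (inv_le_one_of_one_le₀ (by linarith))

lemma integral_laplaceNormSq_add (hd : 2 < Fintype.card ι) :
    (Fintype.card ι - 2) * (∫ s in Ioi 0, laplaceNormSq m s) +
      (m ⬝ᵥ m) * (∫ s in Ioi 0, (1 + 2 * s)⁻¹ * laplaceNormSq m s) = 1 := by
  have h1 := (integrableOn_laplaceNormSq m hd).const_mul (2 - Fintype.card ι : ℝ)
  have h2 := (integrableOn_inv_mul_laplaceNormSq m hd).const_mul (m ⬝ᵥ m)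
  have h := integral_Ioi_of_hasDerivAt_of_tendsto'
    (fun s hs ↦ hasDerivAt_mul_laplaceNormSq m (mem_Ici.1 hs))
    (by simpa only [IntegrableOn, mul_assoc] using! h1.sub h2) (tendsto_mul_laplaceNormSq m hd)
  simp only [mul_assoc] at h
  rw [integral_sub h1 h2, integral_const_mul, integral_const_mul] at h
  simp only [laplaceNormSq, mul_zero, add_zero, log_one, neg_zero, zero_mul, zero_div, sub_zero,
    exp_zero, mul_one] at h ⊢
  linarith

lemma integrable_prod_exp_neg_mul_dotProduct_self (hd : 2 < Fintype.card ι) :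
    Integrable (fun z : (ι → ℝ) × ℝ ↦ exp (-z.2 * (z.1 ⬝ᵥ z.1)))
      ((Measure.pi fun i ↦ gaussianReal (m i) 1).prod (volume.restrict (Ioi 0))) := by
  rw [integrable_prod_iff' (by unfold dotProduct; fun_prop)]
  constructor
  · refine (ae_restrict_iff' measurableSet_Ioi).2 (.of_forall fun s hs ↦ ?_)
    refine Integrable.of_bound (by unfold dotProduct; fun_prop) 1 (.of_forall fun y ↦ ?_)
    rw [norm_of_nonneg (exp_pos _).le, exp_le_one_iff]
    nlinarith [dotProduct_self_nonneg_of_real y, mem_Ioi.1 hs]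
  · refine (integrableOn_laplaceNormSq m hd).congr_fun (fun s hs ↦ ?_) measurableSet_Ioi
    simp only [norm_of_nonneg (exp_pos _).le]
    exact (integral_exp_neg_mul_dotProduct_self m (mem_Ioi.1 hs).le).symm

lemma integrable_inv_dotProduct_self (hd : 2 < Fintype.card ι) :
    Integrable (fun y : ι → ℝ ↦ (y ⬝ᵥ y)⁻¹) (Measure.pi fun i ↦ gaussianReal (m i) 1) := by
  have h := (integrable_prod_exp_neg_mul_dotProduct_self m hd).integral_prod_left
  simpa only [integral_exp_neg_mul_Ioi (dotProduct_self_nonneg_of_real _)] using h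

lemma integral_inv_dotProduct_self (hd : 2 < Fintype.card ι) :
    ∫ y, (y ⬝ᵥ y)⁻¹ ∂Measure.pi (fun i ↦ gaussianReal (m i) 1) =
      ∫ s in Ioi 0, laplaceNormSq m s := by
  have h := integral_integral_swap (f := fun y s ↦ exp (-s * (y ⬝ᵥ y)))
    (integrable_prod_exp_neg_mul_dotProduct_self m hd)
  simp only [integral_exp_neg_mul_Ioi (dotProduct_self_nonneg_of_real _)] at h
  rw [h]
  exact setIntegral_congr_fun measurableSet_Ioi
    fun s hs ↦ integral_exp_neg_mul_dotProduct_self m (mem_Ioi.1 hs).le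

lemma abs_eval_mul_inv_dotProduct_self_le (y : ι → ℝ) (i : ι) :
    |y i| * (y ⬝ᵥ y)⁻¹ ≤ 1 + (y ⬝ᵥ y)⁻¹ := by
  have hq := dotProduct_self_nonneg_of_real y
  have hi : y i * y i ≤ y ⬝ᵥ y :=
    Finset.single_le_sum (f := fun i ↦ y i * y i) (fun i _ ↦ mul_self_nonneg (y i))
      (Finset.mem_univ i)
  rcases hq.eq_or_lt with h | h
  · simp [← h]
  · have : |y i| ≤ y ⬝ᵥ y + 1 := by nlinarith [abs_mul_abs_self (y i), sq_nonneg (|y i| - 1)]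
    calc _ ≤ (y ⬝ᵥ y + 1) * (y ⬝ᵥ y)⁻¹ := by gcongr
      _ = _ := by field_simp

lemma integrable_eval_mul_inv_dotProduct_self (hd : 2 < Fintype.card ι) (i : ι) :
    Integrable (fun y : ι → ℝ ↦ y i * (y ⬝ᵥ y)⁻¹) (Measure.pi fun i ↦ gaussianReal (m i) 1) := by
  refine ((integrable_const 1).add (integrable_inv_dotProduct_self m hd)).mono'
    (by unfold dotProduct; fun_prop) (.of_forall fun y ↦ ?_)
  rw [norm_mul, norm_of_nonneg (inv_nonneg.2 (dotProduct_self_nonneg_of_real y))]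
  exact abs_eval_mul_inv_dotProduct_self_le y i

lemma integrable_prod_eval_mul_exp_neg_mul_dotProduct_self (hd : 2 < Fintype.card ι) (i : ι) :
    Integrable (fun z : (ι → ℝ) × ℝ ↦ z.1 i * exp (-z.2 * (z.1 ⬝ᵥ z.1)))
      ((Measure.pi fun i ↦ gaussianReal (m i) 1).prod (volume.restrict (Ioi 0))) := by
  rw [integrable_prod_iff (by unfold dotProduct; fun_prop)]
  constructor
  · refine .of_forall fun y ↦ ?_
    rcases (dotProduct_self_nonneg_of_real y).eq_or_lt with h | h
    · simp [dotProduct_self_eq_zero.1 h.symm]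
    · have := integrableOn_exp_mul_Ioi (neg_lt_zero.2 h) 0
      simp only [neg_mul, mul_comm (y ⬝ᵥ y)] at this
      simpa only [neg_mul] using! this.const_mul (y i)
  · simp only [norm_mul, norm_of_nonneg (exp_pos _).le, integral_const_mul,
      integral_exp_neg_mul_Ioi (dotProduct_self_nonneg_of_real _)]
    simpa only [norm_mul, norm_of_nonneg (inv_nonneg.2 (dotProduct_self_nonneg_of_real _))] using
      (integrable_eval_mul_inv_dotProduct_self m hd i).norm

lemma integral_eval_mul_inv_dotProduct_self (hd : 2 < Fintype.card ι) (i : ι) :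
    ∫ y, y i * (y ⬝ᵥ y)⁻¹ ∂Measure.pi (fun i ↦ gaussianReal (m i) 1) =
      m i * ∫ s in Ioi 0, (1 + 2 * s)⁻¹ * laplaceNormSq m s := by
  have h := integral_integral_swap (f := fun y s ↦ y i * exp (-s * (y ⬝ᵥ y)))
    (integrable_prod_eval_mul_exp_neg_mul_dotProduct_self m hd i)
  simp only [integral_const_mul, integral_exp_neg_mul_Ioi (dotProduct_self_nonneg_of_real _)] at h
  rw [h, ← integral_const_mul]
  refine setIntegral_congr_fun measurableSet_Ioi fun s hs ↦ ?_
  rw [← mul_assoc, ← div_eq_mul_inv]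
  exact integral_eval_mul_exp_neg_mul_dotProduct_self m i (mem_Ioi.1 hs).le

lemma integrable_dotProduct_mul_inv_dotProduct_self (hd : 2 < Fintype.card ι) :
    Integrable (fun y : ι → ℝ ↦ (m ⬝ᵥ y) * (y ⬝ᵥ y)⁻¹)
      (Measure.pi fun i ↦ gaussianReal (m i) 1) := by
  simp only [dotProduct.eq_1 m, Finset.sum_mul, mul_assoc]
  exact integrable_finsetSum _ fun i _ ↦
    (integrable_eval_mul_inv_dotProduct_self m hd i).const_mul (m i)

/-- Stein's identity for the field `y ↦ y / |y|²`. -/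
lemma integral_dotProduct_mul_inv_dotProduct_self (hd : 2 < Fintype.card ι) :
    ∫ y, (m ⬝ᵥ y) * (y ⬝ᵥ y)⁻¹ ∂Measure.pi (fun i ↦ gaussianReal (m i) 1) =
      1 - (Fintype.card ι - 2) *
        ∫ y, (y ⬝ᵥ y)⁻¹ ∂Measure.pi (fun i ↦ gaussianReal (m i) 1) := by
  rw [integral_inv_dotProduct_self m hd, ← integral_laplaceNormSq_add m hd, add_sub_cancel_left]
  simp only [dotProduct.eq_1 m, Finset.sum_mul, mul_assoc]
  rw [integral_finsetSum _ fun i _ ↦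
    (integrable_eval_mul_inv_dotProduct_self m hd i).const_mul (m i)]
  simp only [integral_const_mul, integral_eval_mul_inv_dotProduct_self m hd]

lemma integrable_eval_sub_sq (i : ι) :
    Integrable (fun y : ι → ℝ ↦ (y i - m i) * (y i - m i))
      (Measure.pi fun i ↦ gaussianReal (m i) 1) := by
  have h : Integrable (fun x : ℝ ↦ (x - m i) * (x - m i)) (gaussianReal (m i) 1) := by
    simpa only [← sq] using! ((memLp_id_gaussianReal 2).sub (memLp_const (m i))).integrable_sq
  exact (measurePreserving_eval (fun i ↦ gaussianReal (m i) 1) i).integrable_comp_of_integrable h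

lemma integrable_dotProduct_self_sub :
    Integrable (fun y : ι → ℝ ↦ (y - m) ⬝ᵥ (y - m)) (Measure.pi fun i ↦ gaussianReal (m i) 1) :=
  integrable_finsetSum _ fun i _ ↦ integrable_eval_sub_sq m i

lemma integral_dotProduct_self_sub :
    ∫ y, (y - m) ⬝ᵥ (y - m) ∂Measure.pi (fun i ↦ gaussianReal (m i) 1) = Fintype.card ι := by
  have h (i : ι) : ∫ y : ι → ℝ, (y i - m i) * (y i - m i)
      ∂Measure.pi (fun i ↦ gaussianReal (m i) 1) = 1 := by
    have hmap := (measurePreserving_eval (fun i ↦ gaussianReal (m i) 1) i).map_eq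
    have hvar := variance_id_gaussianReal (μ := m i) (v := 1)
    rw [variance_eq_integral aemeasurable_id] at hvar
    simp only [id, integral_id_gaussianReal, NNReal.coe_one] at hvar
    rw [← hvar]
    conv_rhs => rw [← hmap]
    rw [integral_map (measurable_pi_apply i).aemeasurable (by fun_prop)]
    simp only [sq]
  simp only [dotProduct, Pi.sub_apply]
  rw [integral_finsetSum _ fun i _ ↦ integrable_eval_sub_sq m i]
  simp [h]

lemma ae_ne_zero_pi_gaussianReal [Nonempty ι] :
    ∀ᵐ y ∂Measure.pi (fun i ↦ gaussianReal (m i) 1), y ≠ 0 := by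
  obtain ⟨i⟩ := ‹Nonempty ι›
  have := nullSingletonClass_gaussianReal (μ := m i) one_ne_zero
  have h : ∀ᵐ x ∂gaussianReal (m i) 1, x ≠ 0 := by simp [ae_iff]
  have heval := measurePreserving_eval (fun i ↦ gaussianReal (m i) 1) i
  filter_upwards [heval.quasiMeasurePreserving.ae h] with y hy hy0
  exact hy (by simp [hy0])

/-- The risk of the James–Stein estimator for a Gaussian vector with identity covariance. -/
lemma integral_jamesStein_sq_error (hd : 2 < Fintype.card ι) :
    ∫ y, ((1 - ((Fintype.card ι : ℝ) - 2) / (y ⬝ᵥ y)) • y - m) ⬝ᵥ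
        ((1 - ((Fintype.card ι : ℝ) - 2) / (y ⬝ᵥ y)) • y - m)
        ∂Measure.pi (fun i ↦ gaussianReal (m i) 1) =
      Fintype.card ι - ((Fintype.card ι : ℝ) - 2) ^ 2 *
        ∫ y, (y ⬝ᵥ y)⁻¹ ∂Measure.pi (fun i ↦ gaussianReal (m i) 1) := by
  have : Nonempty ι := Fintype.card_pos_iff.1 (by omega)
  set k : ℝ := (Fintype.card ι : ℝ) - 2 with hk
  have hexp : ∀ᵐ y ∂Measure.pi (fun i ↦ gaussianReal (m i) 1),
      ((1 - k / (y ⬝ᵥ y)) • y - m) ⬝ᵥ ((1 - k / (y ⬝ᵥ y)) • y - m) =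
        (y - m) ⬝ᵥ (y - m) + (2 * k * ((m ⬝ᵥ y) * (y ⬝ᵥ y)⁻¹) +
          (k ^ 2 * (y ⬝ᵥ y)⁻¹ - 2 * k)) := by
    filter_upwards [ae_ne_zero_pi_gaussianReal m] with y hy
    have hq : y ⬝ᵥ y ≠ 0 := dotProduct_self_eq_zero.not.2 hy
    simp only [sub_dotProduct, dotProduct_sub, smul_dotProduct, dotProduct_smul, smul_eq_mul,
      dotProduct_comm y m]
    field_simp
    ring
  have h1 := integrable_dotProduct_self_sub m
  have h2 := (integrable_dotProduct_mul_inv_dotProduct_self m hd).const_mul (2 * k)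
  have h3 := (integrable_inv_dotProduct_self m hd).const_mul (k ^ 2)
  have h4 : Integrable (fun y : ι → ℝ ↦ k ^ 2 * (y ⬝ᵥ y)⁻¹ - 2 * k)
      (Measure.pi fun i ↦ gaussianReal (m i) 1) := h3.sub (integrable_const _)
  rw [integral_congr_ae hexp, integral_add h1 (by exact h2.add h4), integral_add h2 h4,
    integral_sub h3 (integrable_const _),
    integral_const_mul, integral_const_mul, integral_dotProduct_self_sub,
    integral_dotProduct_mul_inv_dotProduct_self m hd, ← hk]
  simp only [integral_const, probReal_univ, smul_eq_mul, one_mul]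
  ring

end IsotropicGaussian

/-- Cramér–Wold: a random vector all of whose linear functionals are Gaussian with the mean and
variance of an isotropic Gaussian vector has independent Gaussian coordinates. -/
lemma HasGaussianLaw.map_eq_pi {Ω ι : Type*} [Fintype ι] [DecidableEq ι] [MeasurableSpace Ω]
    {μ : Measure Ω} [IsProbabilityMeasure μ] {Y : Ω → ι → ℝ} {m : ι → ℝ}
    (hY : _root_.HasGaussianLaw μ Y m 1) (hYm : AEMeasurable Y μ) :
    μ.map Y = Measure.pi (fun i ↦ gaussianReal (m i) 1) := by
  have := Measure.isProbabilityMeasure_map hYm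
  refine Measure.ext_of_charFunDual (funext fun L ↦ ?_)
  set a : ι → ℝ := fun i ↦ L (Pi.single i 1) with ha
  have hL (y : ι → ℝ) : L y = a ⬝ᵥ y := by
    conv_lhs => rw [← Finset.univ_sum_single y, map_sum]
    refine Finset.sum_congr rfl fun i _ ↦ ?_
    rw [ha, mul_comm, ← smul_eq_mul, ← map_smul, ← Pi.single_smul, smul_eq_mul, mul_one]
  have hmap : (μ.map Y).map L = gaussianReal (a ⬝ᵥ m) (a ⬝ᵥ a).toNNReal := by
    rw [AEMeasurable.map_map_of_aemeasurable (by fun_prop) hYm]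
    simpa [Function.comp_def, hL] using! hY a
  rw [charFunDual_eq_charFun_map_one, hmap, charFun_gaussianReal, charFunDual_pi]
  have hcoord (i : ι) : charFunDual (gaussianReal (m i) 1) (L ∘L .single ℝ (fun _ ↦ ℝ) i) =
      Complex.exp (a i * m i * Complex.I - (a i) ^ 2 / 2) := by
    have hi : ((L ∘L .single ℝ (fun _ ↦ ℝ) i : StrongDual ℝ ℝ) : ℝ → ℝ) = fun x ↦ a i * x := by
      ext x
      simp [hL]
    rw [charFunDual_eq_charFun_map_one, hi, gaussianReal_map_const_mul, charFun_gaussianReal]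
    simp
  simp only [hcoord, ← Complex.exp_sum, Real.coe_toNNReal _ (dotProduct_self_nonneg_of_real a)]
  congr 1
  simp [dotProduct, Finset.sum_sub_distrib, Finset.sum_mul, Finset.sum_div, sq]

lemma HasGaussianLaw.aemeasurable {Ω ι : Type*} [Fintype ι] [MeasurableSpace Ω]
    {μ : Measure Ω} {X : Ω → ι → ℝ} {θ : ι → ℝ} {C : Matrix ι ι ℝ}
    (hX : _root_.HasGaussianLaw μ X θ C) : AEMeasurable X μ := by
  classical
  refine aemeasurable_pi_lambda _ fun i ↦ ?_
  have h : AEMeasurable (fun ω ↦ Pi.single i 1 ⬝ᵥ X ω) μ := by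
    by_contra h
    have := hX (Pi.single i 1)
    rw [Measure.map_of_not_aemeasurable h] at this
    exact IsProbabilityMeasure.ne_zero _ this.symm
  simpa using h

lemma HasGaussianLaw.mulVec {Ω ι κ : Type*} [Fintype ι] [Fintype κ] [MeasurableSpace Ω]
    {μ : Measure Ω} {X : Ω → ι → ℝ} {θ : ι → ℝ} {C : Matrix ι ι ℝ}
    (hX : _root_.HasGaussianLaw μ X θ C) (B : Matrix κ ι ℝ) :
    _root_.HasGaussianLaw μ (fun ω ↦ B *ᵥ X ω) (B *ᵥ θ) (B * C * Bᵀ) := fun a ↦ by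
  have h := hX (a ᵥ* B)
  simpa only [dotProduct_mulVec, ← vecMul_vecMul, vecMul_transpose, ← mulVec_transpose,
    ← mulVec_mulVec, mulVec_mulVec, transpose_mul, Matrix.mul_assoc] using h

/-- A positive definite matrix is whitened by some matrix `B`. -/
lemma Matrix.PosDef.exists_whitening {ι : Type*} [Fintype ι] [DecidableEq ι]
    {S : Matrix ι ι ℝ} (hS : S.PosDef) :
    ∃ B : Matrix ι ι ℝ, Bᵀ * B = S⁻¹ ∧ B * S * Bᵀ = 1 := by
  open scoped MatrixOrder in
  obtain ⟨B, hB⟩ := CStarAlgebra.nonneg_iff_eq_star_mul_self.1 hS.inv.posSemidef.nonneg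
  have hB' : Bᵀ * B = S⁻¹ := by
    rw [hB, star_eq_conjTranspose, conjTranspose_eq_transpose_of_trivial]
  refine ⟨B, hB', ?_⟩
  have hS' : S * Bᵀ * B = 1 := by
    rw [Matrix.mul_assoc, hB', mul_nonsing_inv _ ((isUnit_iff_isUnit_det S).1 hS.isUnit)]
  rw [Matrix.mul_assoc]
  exact mul_eq_one_comm.1 hS'

/-- James–Stein error formula: for `X ~ N(θ, Σ)` with `Σ` positive definite, `d > 2`,
and `θ̂(X) = (1 - (d-2)/(XᵀSig⁻¹X)) X`, one has
`E[(θ̂-θ)ᵀSig⁻¹(θ̂-θ)] = d - (d-2)² E[1/(XᵀSig⁻¹X)]`. -/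
theorem stmt_8 {d : ℕ} (hd : 2 < d) {Ω : Type*} [MeasurableSpace Ω]
    (μ : Measure Ω) [IsProbabilityMeasure μ]
    (θ : Fin d → ℝ) (Sig : Matrix (Fin d) (Fin d) ℝ) (hSig : Sig.PosDef)
    (X : Ω → Fin d → ℝ) (hX : HasGaussianLaw μ X θ Sig)
    (θhat : Ω → Fin d → ℝ)
    (hθhat : ∀ ω, θhat ω = (1 - ((d : ℝ) - 2) / (X ω ⬝ᵥ (Sig⁻¹ *ᵥ X ω))) • X ω) :
    ∫ ω, (θhat ω - θ) ⬝ᵥ (Sig⁻¹ *ᵥ (θhat ω - θ)) ∂μ =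
      (d : ℝ) - ((d : ℝ) - 2) ^ 2 * ∫ ω, (X ω ⬝ᵥ (Sig⁻¹ *ᵥ X ω))⁻¹ ∂μ := by
  obtain ⟨B, hB, hBS⟩ := hSig.exists_whitening
  have hform (v : Fin d → ℝ) : v ⬝ᵥ (Sig⁻¹ *ᵥ v) = (B *ᵥ v) ⬝ᵥ (B *ᵥ v) := by
    rw [← hB, ← mulVec_mulVec, dotProduct_mulVec, vecMul_transpose]
  have hXm := HasGaussianLaw.aemeasurable hX
  have hYm : AEMeasurable (fun ω ↦ B *ᵥ X ω) μ :=
    (by fun_prop : Continuous fun v : Fin d → ℝ ↦ B *ᵥ v).measurable.comp_aemeasurable hXm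
  have hY := HasGaussianLaw.mulVec hX B
  rw [hBS] at hY
  have hmap := HasGaussianLaw.map_eq_pi hY hYm
  have hmain := integral_jamesStein_sq_error (B *ᵥ θ) (by simpa using hd)
  rw [← hmap, integral_map hYm (by unfold dotProduct; fun_prop),
    integral_map hYm (by unfold dotProduct; fun_prop)] at hmain
  simp only [hform, hθhat]
  simpa only [mulVec_sub, mulVec_smul, Fintype.card_fin] using hmain
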